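/- The constants A_Γ and A_0 associated with the minimizer μ_a satisfy the strict inequality A_Γ > A_0. -/

import Mathlib

open MeasureTheory Real
open scoped ENNReal

abbrev Plane : Type := EuclideanSpace ℝ (Fin 2)

noncomputable def logKernel (x y : Plane) : ℝ := Real.log (1 / dist x y)

/- For a probability measure `μ`, `wEnergy μ` equals `I[μ] + 1` where
`I[μ] = ∫∫ log(1/|x-y|) dμdμ + ∫ |x|² dμ ∈ (-∞, +∞]`
(the kernel takes the value `+∞` on the diagonal). -/
open Classical in
noncomputable def wKernel (x y : Plane) : ℝ≥0∞ :=
  if x = y then ⊤ else ENNReal.ofReal (logKernel x y + (‖x‖ ^ 2 + ‖y‖ ^ 2) / 2 + 1)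

noncomputable def wEnergy (μ : Measure Plane) : ℝ≥0∞ :=
  ∫⁻ p : Plane × Plane, wKernel p.1 p.2 ∂(μ.prod μ)

def Ma (Γ : Set Plane) (a : ℝ) : Set (Measure Plane) :=
  {μ | IsProbabilityMeasure μ ∧ ENNReal.ofReal a ≤ μ Γ}

def IsMinimizer (Γ : Set Plane) (a : ℝ) (μa : Measure Plane) : Prop :=
  μa ∈ Ma Γ a ∧ wEnergy μa < ⊤ ∧ ∀ μ ∈ Ma Γ a, wEnergy μa ≤ wEnergy μ

structure RegularCurve (γ : ℝ → Plane) (Γ : Set Plane) : Prop where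
  injective : Function.Injective γ
  image : Γ = Set.range γ
  closed : IsClosed Γ
  contDiff : ContDiff ℝ 1 γ
  unitSpeed : ∀ t, ‖deriv γ t‖ = 1
  holder : ∃ α : ℝ, α ∈ Set.Ioc (0:ℝ) 1 ∧ ∃ M : ℝ, 0 ≤ M ∧
    ∀ s t : ℝ, ‖deriv γ t - deriv γ s‖ ≤ M * |t - s| ^ α


/-- The logarithmic potential `U^μ(x) = ∫ log(1/|x-y|) dμ(y)`. -/
noncomputable def logPot (μ : Measure Plane) (x : Plane) : ℝ := ∫ y, logKernel x y ∂μ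

/-- `A_Γ = (1/a) ∫_Γ (2U^{μ_a}(x) + |x|²) dμ_a(x)`. -/
noncomputable def AΓ (Γ : Set Plane) (a : ℝ) (μa : Measure Plane) : ℝ :=
  a⁻¹ * ∫ x in Γ, (2 * logPot μa x + ‖x‖ ^ 2) ∂μa

/-- `A_0 = (1/(1-a)) ∫_{ℝ²∖Γ} (2U^{μ_a}(x) + |x|²) dμ_a(x)`. -/
noncomputable def A0 (Γ : Set Plane) (a : ℝ) (μa : Measure Plane) : ℝ :=
  (1 - a)⁻¹ * ∫ x in Γᶜ, (2 * logPot μa x + ‖x‖ ^ 2) ∂μa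

/-- The finite branch of `wKernel`. -/
noncomputable def wReal (x y : Plane) : ℝ := logKernel x y + (‖x‖ ^ 2 + ‖y‖ ^ 2) / 2 + 1

/-- The bilinear form polarizing `wEnergy`. -/
noncomputable def mutualEnergy (μ ν : Measure Plane) : ℝ≥0∞ :=
  ∫⁻ x, ∫⁻ y, wKernel x y ∂ν ∂μ

lemma logKernel_eq (x y : Plane) : logKernel x y = -Real.log (dist x y) := by
  simp [logKernel]

lemma wKernel_self (x : Plane) : wKernel x x = ⊤ := by simp [wKernel]

lemma wKernel_of_ne {x y : Plane} (h : x ≠ y) : wKernel x y = ENNReal.ofReal (wReal x y) := by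
  simp [wKernel, h, wReal]

lemma le_wReal (x y : Plane) : 3 / 8 * (‖x‖ ^ 2 + ‖y‖ ^ 2) ≤ wReal x y := by
  unfold wReal
  rw [logKernel_eq]
  rcases eq_or_ne x y with rfl | h
  · simp only [dist_self, Real.log_zero]
    nlinarith [sq_nonneg ‖x‖]
  have hd : 0 < dist x y := dist_pos.2 h
  have h1 : dist x y ^ 2 ≤ 2 * (‖x‖ ^ 2 + ‖y‖ ^ 2) := by
    have : dist x y ≤ ‖x‖ + ‖y‖ := by rw [dist_eq_norm]; exact norm_sub_le x y
    nlinarith [sq_nonneg (‖x‖ - ‖y‖), norm_nonneg x, norm_nonneg y]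
  have h2 : Real.log (dist x y ^ 2 / 8) ≤ dist x y ^ 2 / 8 - 1 :=
    Real.log_le_sub_one_of_pos (by positivity)
  rw [Real.log_div (by positivity) (by norm_num), Real.log_pow,
    show (8 : ℝ) = 2 ^ 3 by norm_num, Real.log_pow] at h2
  have h3 := Real.log_two_lt_d9
  push_cast at h2
  linarith

lemma wReal_nonneg (x y : Plane) : 0 ≤ wReal x y :=
  le_trans (by positivity) (le_wReal x y)

lemma wKernel_comm (x y : Plane) : wKernel x y = wKernel y x := by
  rcases eq_or_ne x y with rfl | h
  · rfl
  · rw [wKernel_of_ne h, wKernel_of_ne h.symm]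
    simp only [wReal, logKernel, dist_comm x y, add_comm (‖x‖ ^ 2)]

lemma ofReal_wReal_le (x y : Plane) : ENNReal.ofReal (wReal x y) ≤ wKernel x y := by
  rcases eq_or_ne x y with rfl | h
  · simp [wKernel_self]
  · rw [wKernel_of_ne h]

@[fun_prop]
lemma measurable_logKernel : Measurable fun p : Plane × Plane => logKernel p.1 p.2 := by
  unfold logKernel
  fun_prop

@[fun_prop]
lemma measurable_wReal : Measurable fun p : Plane × Plane => wReal p.1 p.2 := by
  unfold wReal
  fun_prop

lemma measurable_wKernel : Measurable fun p : Plane × Plane => wKernel p.1 p.2 := by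
  unfold wKernel
  refine Measurable.ite (measurableSet_eq_fun measurable_fst measurable_snd) measurable_const ?_
  exact (measurable_wReal).ennreal_ofReal

lemma measurable_lintegral_wKernel (ν : Measure Plane) [SFinite ν] :
    Measurable fun x => ∫⁻ y, wKernel x y ∂ν :=
  measurable_wKernel.lintegral_prod_right'

lemma wEnergy_eq_mutualEnergy (μ : Measure Plane) [SFinite μ] :
    wEnergy μ = mutualEnergy μ μ :=
  lintegral_prod _ measurable_wKernel.aemeasurable

lemma mutualEnergy_comm (μ ν : Measure Plane) [SFinite μ] [SFinite ν] :
    mutualEnergy μ ν = mutualEnergy ν μ := by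
  unfold mutualEnergy
  rw [lintegral_lintegral_swap measurable_wKernel.aemeasurable]
  simp_rw [wKernel_comm]

lemma mutualEnergy_add_left (μ μ' ν : Measure Plane) :
    mutualEnergy (μ + μ') ν = mutualEnergy μ ν + mutualEnergy μ' ν :=
  lintegral_add_measure _ _ _

lemma mutualEnergy_smul_left (c : ℝ≥0∞) (μ ν : Measure Plane) :
    mutualEnergy (c • μ) ν = c * mutualEnergy μ ν :=
  lintegral_smul_measure _ _

lemma mutualEnergy_add_right (μ ν ν' : Measure Plane) [SFinite ν] :
    mutualEnergy μ (ν + ν') = mutualEnergy μ ν + mutualEnergy μ ν' := by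
  unfold mutualEnergy
  simp_rw [lintegral_add_measure]
  exact lintegral_add_left (measurable_lintegral_wKernel ν) _

lemma mutualEnergy_smul_right (c : ℝ≥0∞) (μ ν : Measure Plane) [SFinite ν] :
    mutualEnergy μ (c • ν) = c * mutualEnergy μ ν := by
  unfold mutualEnergy
  simp_rw [lintegral_smul_measure, smul_eq_mul]
  exact lintegral_const_mul _ (measurable_lintegral_wKernel ν)

lemma mutualEnergy_mono_left {μ μ' : Measure Plane} (h : μ ≤ μ') (ν : Measure Plane) :
    mutualEnergy μ ν ≤ mutualEnergy μ' ν :=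
  lintegral_mono' h le_rfl

/-- First-order condition for a minimizer along the segment from `μ` to `η`. -/
lemma mutualEnergy_self_le_of_segment {μ η : Measure Plane} [IsFiniteMeasure μ]
    [IsFiniteMeasure η] (hμ : mutualEnergy μ μ ≠ ⊤) (hμη : mutualEnergy μ η ≠ ⊤)
    (hη : mutualEnergy η η ≠ ⊤) {t₀ : ℝ} (ht₀ : 0 < t₀) (ht₁ : t₀ ≤ 1)
    (h : ∀ t : ℝ, 0 < t → t ≤ t₀ → mutualEnergy μ μ ≤
      mutualEnergy (ENNReal.ofReal (1 - t) • μ + ENNReal.ofReal t • η)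
        (ENNReal.ofReal (1 - t) • μ + ENNReal.ofReal t • η)) :
    mutualEnergy μ μ ≤ mutualEnergy μ η := by
  have key : ∀ t : ℝ, 0 < t → t ≤ t₀ → (mutualEnergy μ μ).toReal ≤
      (1 - t) ^ 2 * (mutualEnergy μ μ).toReal + 2 * t * (1 - t) * (mutualEnergy μ η).toReal
        + t ^ 2 * (mutualEnergy η η).toReal := by
    intro t ht ht'
    have h1 := h t ht ht'
    have : IsFiniteMeasure (ENNReal.ofReal (1 - t) • μ) :=
      Measure.smul_finite μ ENNReal.ofReal_ne_top
    have : IsFiniteMeasure (ENNReal.ofReal t • η) :=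
      Measure.smul_finite η ENNReal.ofReal_ne_top
    simp only [mutualEnergy_add_left, mutualEnergy_add_right, mutualEnergy_smul_left,
      mutualEnergy_smul_right, mutualEnergy_comm η μ] at h1
    rw [← ENNReal.ofReal_toReal hμ, ← ENNReal.ofReal_toReal hμη, ← ENNReal.ofReal_toReal hη] at h1
    have ht1 : 0 ≤ 1 - t := by linarith
    have e1 : 0 ≤ (mutualEnergy μ μ).toReal := ENNReal.toReal_nonneg
    have e2 : 0 ≤ (mutualEnergy μ η).toReal := ENNReal.toReal_nonneg
    have e3 : 0 ≤ (mutualEnergy η η).toReal := ENNReal.toReal_nonneg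
    generalize (mutualEnergy μ μ).toReal = p at *
    generalize (mutualEnergy μ η).toReal = q at *
    generalize (mutualEnergy η η).toReal = s at *
    rw [← ENNReal.ofReal_mul ht1, ← ENNReal.ofReal_mul ht1, ← ENNReal.ofReal_mul ht.le,
      ← ENNReal.ofReal_mul ht.le, ← ENNReal.ofReal_add (by positivity) (by positivity),
      ← ENNReal.ofReal_add (by positivity) (by positivity), ← ENNReal.ofReal_mul ht1,
      ← ENNReal.ofReal_mul ht.le, ← ENNReal.ofReal_add (by positivity) (by positivity),
      ENNReal.ofReal_le_ofReal_iff (by positivity)] at h1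
    linarith
  rw [← ENNReal.toReal_le_toReal hμ hμη]
  generalize (mutualEnergy μ μ).toReal = p at *
  generalize (mutualEnergy μ η).toReal = q at *
  generalize (mutualEnergy η η).toReal = s at *
  by_contra! hlt
  set c := |p - 2 * q + s| + 1
  have hcpos : 0 < c := by positivity
  have hpos : 0 < min t₀ ((p - q) / c) := lt_min ht₀ (div_pos (by linarith) hcpos)
  have hk := key _ hpos (min_le_left _ _)
  have hle : min t₀ ((p - q) / c) * c ≤ p - q := by
    rw [← le_div_iff₀ hcpos]; exact min_le_right _ _
  generalize min t₀ ((p - q) / c) = t at *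
  have h2 : t * (2 * (p - q)) ≤ t * (t * (p - 2 * q + s)) := by nlinarith
  have h3 := le_of_mul_le_mul_left h2 hpos
  have h4 : t * (p - 2 * q + s) ≤ t * c := by
    apply mul_le_mul_of_nonneg_left _ hpos.le
    linarith [le_abs_self (p - 2 * q + s)]
  linarith

/-- The uniform probability measure on `(0, 2π]`. -/
noncomputable def angleMeasure : Measure ℝ :=
  ENNReal.ofReal ((2 * π)⁻¹) • volume.restrict (Set.Ioc 0 (2 * π))

instance : IsProbabilityMeasure angleMeasure := by
  constructor
  simp only [angleMeasure, Measure.smul_apply, Measure.restrict_apply_univ, Real.volume_Ioc,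
    sub_zero, smul_eq_mul]
  rw [← ENNReal.ofReal_mul (by positivity), inv_mul_cancel₀ (by positivity), ENNReal.ofReal_one]

/-- The parametrization of the circle of radius `r` about the origin of `Plane`. -/
noncomputable def circlePoint (r θ : ℝ) : Plane :=
  Complex.orthonormalBasisOneI.repr (circleMap 0 r θ)

lemma measurable_circlePoint (r : ℝ) : Measurable (circlePoint r) := by
  unfold circlePoint
  have := continuous_circleMap 0 r
  exact (Complex.orthonormalBasisOneI.repr.continuous.comp this).measurable

/-- The uniform probability measure on the circle of radius `r` about the origin. -/
noncomputable def circleMeasure (r : ℝ) : Measure Plane := angleMeasure.map (circlePoint r)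

instance (r : ℝ) : IsProbabilityMeasure (circleMeasure r) :=
  Measure.isProbabilityMeasure_map (measurable_circlePoint r).aemeasurable

lemma integral_angleMeasure (f : ℝ → ℝ) :
    ∫ θ, f θ ∂angleMeasure = (2 * π)⁻¹ * ∫ θ in 0..2 * π, f θ := by
  rw [angleMeasure, integral_smul_measure, intervalIntegral.integral_of_le (by positivity),
    ENNReal.toReal_ofReal (by positivity), smul_eq_mul]

lemma integrable_angleMeasure {f : ℝ → ℝ} (hf : IntervalIntegrable f volume 0 (2 * π)) :
    Integrable f angleMeasure := by
  rw [intervalIntegrable_iff_integrableOn_Ioc_of_le (by positivity)] at hf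
  exact hf.integrable.smul_measure ENNReal.ofReal_ne_top

lemma dist_add_circlePoint (x y : Plane) (r θ : ℝ) :
    dist x (y + circlePoint r θ) =
      ‖circleMap 0 r θ - Complex.orthonormalBasisOneI.repr.symm (x - y)‖ := by
  rw [dist_comm, dist_eq_norm, ← Complex.orthonormalBasisOneI.repr.norm_map]
  simp only [map_sub, LinearIsometryEquiv.apply_symm_apply]
  congr 1
  unfold circlePoint
  abel

lemma norm_add_circlePoint_sq (y : Plane) (r θ : ℝ) :
    ‖y + circlePoint r θ‖ ^ 2 =
      ‖y‖ ^ 2 + r ^ 2 + (2 * r * y 0 * Real.cos θ + 2 * r * y 1 * Real.sin θ) := by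
  have h0 : circlePoint r θ 0 = r * Real.cos θ := by
    simp [circlePoint, Complex.orthonormalBasisOneI_repr_apply, circleMap_zero]
  have h1 : circlePoint r θ 1 = r * Real.sin θ := by
    simp [circlePoint, Complex.orthonormalBasisOneI_repr_apply, circleMap_zero]
  rw [EuclideanSpace.norm_sq_eq, EuclideanSpace.norm_sq_eq]
  simp only [Fin.sum_univ_two, PiLp.add_apply, h0, h1, Real.norm_eq_abs, sq_abs]
  linear_combination r ^ 2 * Real.sin_sq_add_cos_sq θ

lemma integrable_wReal_circle (x y : Plane) (r : ℝ) :
    Integrable (fun θ => wReal x (y + circlePoint r θ)) angleMeasure := by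
  apply integrable_angleMeasure
  simp only [wReal, logKernel_eq, dist_add_circlePoint, norm_add_circlePoint_sq]
  have h := circleIntegrable_log_norm_sub_const (c := 0)
    (a := Complex.orthonormalBasisOneI.repr.symm (x - y)) r
  refine (IntervalIntegrable.add ?_ ?_).add ?_
  · exact h.neg
  · exact Continuous.intervalIntegrable (by fun_prop) _ _
  · exact Continuous.intervalIntegrable (by fun_prop) _ _

lemma integral_wReal_circle (x y : Plane) {r : ℝ} (hr : 0 < r) :
    ∫ θ, wReal x (y + circlePoint r θ) ∂angleMeasure =
      -(Real.log r + Real.posLog (r⁻¹ * dist x y)) + (‖x‖ ^ 2 + ‖y‖ ^ 2 + r ^ 2) / 2 + 1 := by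
  rw [integral_angleMeasure]
  simp only [wReal, logKernel_eq, dist_add_circlePoint, norm_add_circlePoint_sq]
  have h := circleIntegrable_log_norm_sub_const (c := 0)
    (a := Complex.orthonormalBasisOneI.repr.symm (x - y)) r
  have hav := circleAverage_log_norm_sub_const_eq_log_radius_add_posLog (c := 0)
    (a := Complex.orthonormalBasisOneI.repr.symm (x - y)) hr.ne'
  rw [zero_sub, norm_neg, LinearIsometryEquiv.norm_map, ← dist_eq_norm, circleAverage_def,
    smul_eq_mul] at hav
  rw [← hav]
  have h_int : ∫ θ in 0..2 * π, ((‖x‖ ^ 2 + (‖y‖ ^ 2 + r ^ 2 +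
      (2 * r * y 0 * Real.cos θ + 2 * r * y 1 * Real.sin θ))) / 2 + 1) =
      2 * π * ((‖x‖ ^ 2 + ‖y‖ ^ 2 + r ^ 2) / 2 + 1) := by
    have e : ∀ θ : ℝ, (‖x‖ ^ 2 + (‖y‖ ^ 2 + r ^ 2 +
      (2 * r * y 0 * Real.cos θ + 2 * r * y 1 * Real.sin θ))) / 2 + 1 =
      ((‖x‖ ^ 2 + ‖y‖ ^ 2 + r ^ 2) / 2 + 1) +
        (r * y 0 * Real.cos θ + r * y 1 * Real.sin θ) := by intro θ; ring
    simp_rw [e]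
    rw [intervalIntegral.integral_add (Continuous.intervalIntegrable (by fun_prop) _ _)
      (Continuous.intervalIntegrable (by fun_prop) _ _),
      intervalIntegral.integral_add (Continuous.intervalIntegrable (by fun_prop) _ _)
      (Continuous.intervalIntegrable (by fun_prop) _ _)]
    simp
    ring
  have hn : IntervalIntegrable (fun θ => -Real.log ‖circleMap 0 r θ -
      Complex.orthonormalBasisOneI.repr.symm (x - y)‖) volume 0 (2 * π) := h.neg
  simp_rw [add_assoc (-Real.log _)]
  rw [intervalIntegral.integral_add hn (Continuous.intervalIntegrable (by fun_prop) _ _),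
    h_int, intervalIntegral.integral_neg]
  field_simp
  ring

lemma lintegral_wKernel_circle (x y : Plane) {r : ℝ} (hr : 0 < r) :
    ∫⁻ e, wKernel x (y + e) ∂circleMeasure r =
      ENNReal.ofReal (∫ θ, wReal x (y + circlePoint r θ) ∂angleMeasure) := by
  have hm : Measurable fun e => wKernel x (y + e) :=
    measurable_wKernel.comp (measurable_const.prodMk (measurable_const.add measurable_id))
  rw [circleMeasure, lintegral_map hm (measurable_circlePoint r),
    ofReal_integral_eq_lintegral_ofReal (integrable_wReal_circle x y r)
      (Filter.Eventually.of_forall fun _ => wReal_nonneg _ _)]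
  apply lintegral_congr_ae
  have hc : (circleMap 0 r ⁻¹'
      {Complex.orthonormalBasisOneI.repr.symm (x - y)}).Countable :=
    (Set.countable_singleton _).preimage_circleMap 0 hr.ne'
  have hac : angleMeasure ≪ volume :=
    (Measure.smul_absolutelyContinuous).trans Measure.absolutelyContinuous_restrict
  have hae := hac.ae_le (hc.ae_notMem volume)
  filter_upwards [hae] with θ hθ
  apply wKernel_of_ne
  intro h
  rw [← dist_eq_zero, dist_add_circlePoint, norm_eq_zero, sub_eq_zero] at h
  exact hθ h

/-- Averaging over circles raises the quadratic part of the kernel by `r² / 2` and lowers the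
logarithmic part by at least `log 2` near the diagonal. -/
lemma lintegral_wKernel_circle_add_le (x y : Plane) {r : ℝ} (hr : 0 < r) :
    ∫⁻ e, wKernel x (y + e) ∂circleMeasure r +
      (Metric.closedBall x (r / 2)).indicator (fun _ => ENNReal.ofReal (Real.log 2)) y ≤
      wKernel x y + ENNReal.ofReal (r ^ 2 / 2) := by
  rcases eq_or_ne x y with rfl | hne
  · simp [wKernel_self]
  have hd : 0 < dist x y := dist_pos.2 hne
  have h0 : 0 ≤ ∫ θ, wReal x (y + circlePoint r θ) ∂angleMeasure :=
    integral_nonneg fun _ => wReal_nonneg _ _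
  rw [lintegral_wKernel_circle x y hr, wKernel_of_ne hne,
    ← ENNReal.ofReal_add (wReal_nonneg _ _) (by positivity)]
  rw [integral_wReal_circle x y hr] at h0 ⊢
  by_cases hb : y ∈ Metric.closedBall x (r / 2)
  · rw [Set.indicator_of_mem hb, ← ENNReal.ofReal_add h0 (Real.log_nonneg (by norm_num))]
    apply ENNReal.ofReal_le_ofReal
    rw [Metric.mem_closedBall, dist_comm] at hb
    have h1 := Real.log_le_log hd hb
    rw [Real.log_div hr.ne' (by norm_num)] at h1
    have h2 := Real.posLog_nonneg (x := r⁻¹ * dist x y)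
    simp only [wReal, logKernel_eq]
    linarith
  · rw [Set.indicator_of_notMem hb, add_zero]
    apply ENNReal.ofReal_le_ofReal
    have h1 : Real.log (r⁻¹ * dist x y) ≤ Real.posLog (r⁻¹ * dist x y) := le_max_right _ _
    rw [Real.log_mul (by positivity) hd.ne', Real.log_inv] at h1
    simp only [wReal, logKernel_eq]
    linarith

lemma mutualEnergy_conv_right (μ ν σ : Measure Plane) [SFinite ν] [SFinite σ] :
    mutualEnergy μ (ν.conv σ) = ∫⁻ x, ∫⁻ y, ∫⁻ e, wKernel x (y + e) ∂σ ∂ν ∂μ := by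
  unfold mutualEnergy
  congr 1 with x
  exact Measure.lintegral_conv (measurable_wKernel.comp (measurable_const.prodMk measurable_id))

lemma mutualEnergy_conv_circle_add_le (μ ν : Measure Plane) [IsProbabilityMeasure μ]
    [IsProbabilityMeasure ν] {r : ℝ} (hr : 0 < r) :
    mutualEnergy μ (ν.conv (circleMeasure r)) +
      ENNReal.ofReal (Real.log 2) * ∫⁻ x, ν (Metric.closedBall x (r / 2)) ∂μ ≤
      mutualEnergy μ ν + ENNReal.ofReal (r ^ 2 / 2) := by
  have hm : Measurable fun p : Plane × Plane => ∫⁻ e, wKernel p.1 (p.2 + e) ∂circleMeasure r := by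
    have : Measurable fun q : (Plane × Plane) × Plane => wKernel q.1.1 (q.1.2 + q.2) :=
      measurable_wKernel.comp (by fun_prop : Measurable fun q : (Plane × Plane) × Plane =>
        (q.1.1, q.1.2 + q.2))
    exact this.lintegral_prod_right'
  have hb : ∀ x : Plane, ENNReal.ofReal (Real.log 2) * ν (Metric.closedBall x (r / 2)) =
      ∫⁻ y, (Metric.closedBall x (r / 2)).indicator
        (fun _ => ENNReal.ofReal (Real.log 2)) y ∂ν := fun x => by
    rw [lintegral_indicator_const Metric.isClosed_closedBall.measurableSet]
  rw [mutualEnergy_conv_right, ← lintegral_const_mul' _ _ ENNReal.ofReal_ne_top,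
    ← lintegral_add_left (by exact hm.lintegral_prod_right')]
  calc _ ≤ ∫⁻ x, ∫⁻ y, (wKernel x y + ENNReal.ofReal (r ^ 2 / 2)) ∂ν ∂μ := by
        gcongr with x
        rw [hb, ← lintegral_add_left (by exact hm.comp measurable_prodMk_left)]
        exact lintegral_mono fun y => lintegral_wKernel_circle_add_le x y hr
    _ = _ := by
        simp only [lintegral_add_right _ measurable_const, lintegral_const, measure_univ, mul_one]
        rfl

lemma mutualEnergy_conv_circle_le (μ ν : Measure Plane) [IsProbabilityMeasure μ]
    [IsProbabilityMeasure ν] {r : ℝ} (hr : 0 < r) :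
    mutualEnergy μ (ν.conv (circleMeasure r)) ≤ mutualEnergy μ ν + ENNReal.ofReal (r ^ 2 / 2) :=
  le_self_add.trans (mutualEnergy_conv_circle_add_le μ ν hr)

/-- A measure charging a curve of unit speed has atypically large mass near the diagonal. -/
lemma exists_radius_lt_lintegral_closedBall {γ : ℝ → Plane} {Γ : Set Plane}
    (hΓ : RegularCurve γ Γ) (μ : Measure Plane) [IsProbabilityMeasure μ] (h : 0 < μ Γ) :
    ∃ r : ℝ, 0 < r ∧ ENNReal.ofReal (r ^ 2 / 2) <
      ENNReal.ofReal (Real.log 2) * ∫⁻ x, μ (Metric.closedBall x (r / 2)) ∂μ := by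
  have hlip : LipschitzWith 1 γ :=
    lipschitzWith_of_nnnorm_deriv_le (hΓ.contDiff.differentiable (by norm_num))
      fun t => by rw [← NNReal.coe_le_coe, coe_nnnorm, hΓ.unitSpeed]; rfl
  obtain ⟨N, hN⟩ : ∃ N : ℕ, 0 < μ (γ '' Set.Ico (-(N : ℝ)) N) := by
    by_contra! hcon
    have hcov : Γ ⊆ ⋃ N : ℕ, γ '' Set.Ico (-(N : ℝ)) N := by
      rw [hΓ.image]
      rintro _ ⟨t, rfl⟩
      obtain ⟨N, hN⟩ := exists_nat_gt |t|
      rw [abs_lt] at hN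
      exact Set.mem_iUnion.2 ⟨N, t, ⟨hN.1.le, hN.2⟩, rfl⟩
    exact h.ne' (measure_mono_null hcov (measure_iUnion_null fun N => le_antisymm (hcon N) bot_le))
  set m := μ.real (γ '' Set.Ico (-(N : ℝ)) N)
  have hmpos : 0 < m := ENNReal.toReal_pos hN.ne' (measure_ne_top _ _)
  have hl2 : 0 < Real.log 2 := Real.log_pos (by norm_num)
  obtain ⟨k, hk⟩ := exists_nat_gt (4 * N / (Real.log 2 * m ^ 2))
  have hkpos : (0 : ℝ) < k := lt_of_le_of_lt (by positivity) hk
  let T : ℤ → Set ℝ := fun i => {t | ⌊k * t⌋ = i}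
  let P : ℤ → Set Plane := fun i => γ '' T i
  let I : Finset ℤ := Finset.Ico (-(N * k : ℤ)) (N * k)
  have hTm : ∀ i, MeasurableSet (T i) := fun i =>
    (Int.measurable_floor.comp (measurable_const.mul measurable_id)) (measurableSet_singleton i)
  have hPm : ∀ i, MeasurableSet (P i) := fun i =>
    (hTm i).image_of_continuousOn_injOn hΓ.contDiff.continuous.continuousOn
      hΓ.injective.injOn
  have hPd : Set.PairwiseDisjoint (I : Set ℤ) P := by
    intro i _ j _ hij
    apply Set.disjoint_image_of_injective hΓ.injective
    rw [Set.disjoint_left]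
    intro t hi hj
    exact hij (hi.symm.trans hj)
  have hsub : γ '' Set.Ico (-(N : ℝ)) N ⊆ ⋃ i ∈ I, P i := by
    rintro _ ⟨t, ht, rfl⟩
    refine Set.mem_biUnion (x := ⌊k * t⌋) ?_ ⟨t, rfl, rfl⟩
    simp only [I, Finset.coe_Ico, Set.mem_Ico, Int.le_floor, Int.floor_lt]
    push_cast
    constructor <;> nlinarith [ht.1, ht.2]
  have hball : ∀ i, ∀ x ∈ P i, P i ⊆ Metric.closedBall x (2 / k / 2 : ℝ) := by
    rintro i _ ⟨s, hs, rfl⟩ _ ⟨t, ht, rfl⟩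
    rw [Metric.mem_closedBall]
    refine (hlip.dist_le_mul t s).trans ?_
    have h1 : |k * t - k * s| < 1 := Int.abs_sub_lt_one_of_floor_eq_floor (ht.trans hs.symm)
    rw [← mul_sub, abs_mul, abs_of_pos hkpos] at h1
    rw [NNReal.coe_one, one_mul, Real.dist_eq, div_right_comm, div_self two_ne_zero,
      le_div_iff₀ hkpos]
    linarith
  have hsum : m ≤ ∑ i ∈ I, μ.real (P i) :=
    (measureReal_mono hsub (measure_ne_top _ _)).trans (measureReal_biUnion_finset_le I P)
  have hcard : (I.card : ℝ) = 2 * N * k := by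
    have : I.card = 2 * N * k := by
      simp only [I, Int.card_Ico]
      have : ((N : ℤ) * k - -(N * k)) = ((2 * N * k : ℕ) : ℤ) := by push_cast; ring
      rw [this, Int.toNat_natCast]
    rw [this]
    push_cast
    ring
  have hCS : m ^ 2 ≤ 2 * N * k * ∑ i ∈ I, μ.real (P i) ^ 2 := by
    rw [← hcard]
    exact (pow_le_pow_left₀ hmpos.le hsum 2).trans sq_sum_le_card_mul_sum_sq
  refine ⟨2 / k, by positivity, ?_⟩
  have hlow : ENNReal.ofReal (∑ i ∈ I, μ.real (P i) ^ 2) ≤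
      ∫⁻ x, μ (Metric.closedBall x (2 / k / 2 : ℝ)) ∂μ := by
    calc ENNReal.ofReal (∑ i ∈ I, μ.real (P i) ^ 2) = ∑ i ∈ I, μ (P i) * μ (P i) := by
          rw [ENNReal.ofReal_sum_of_nonneg fun _ _ => by positivity]
          refine Finset.sum_congr rfl fun i _ => ?_
          rw [ENNReal.ofReal_pow measureReal_nonneg, ofReal_measureReal, sq]
      _ ≤ ∑ i ∈ I, ∫⁻ x in P i, μ (Metric.closedBall x (2 / k / 2 : ℝ)) ∂μ := by
          gcongr with i
          rw [← setLIntegral_const]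
          exact setLIntegral_mono' (hPm i) fun x hx => measure_mono (hball i x hx)
      _ = ∫⁻ x in ⋃ i ∈ I, P i, μ (Metric.closedBall x (2 / k / 2 : ℝ)) ∂μ :=
          (lintegral_biUnion_finset hPd (fun i _ => hPm i) _).symm
      _ ≤ _ := setLIntegral_le_lintegral _ _
  refine lt_of_lt_of_le ?_ (mul_le_mul_right hlow _)
  rw [← ENNReal.ofReal_mul hl2.le]
  have hNpos : (0 : ℝ) < N := by
    rcases Nat.eq_zero_or_pos N with rfl | hp
    · simp at hN
    · exact_mod_cast hp
  rw [div_lt_iff₀ (by positivity)] at hk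
  have hgoal : (2 / (k : ℝ)) ^ 2 / 2 < Real.log 2 * ∑ i ∈ I, μ.real (P i) ^ 2 := by
    have h1 : (2 / (k : ℝ)) ^ 2 / 2 = 2 / (k : ℝ) ^ 2 := by field_simp
    rw [h1, div_lt_iff₀ (by positivity)]
    generalize (∑ i ∈ I, μ.real (P i) ^ 2) = S at *
    have h2 : Real.log 2 * m ^ 2 ≤ Real.log 2 * (2 * N * k * S) :=
      mul_le_mul_of_nonneg_left hCS hl2.le
    have h3 : 4 * (N : ℝ) < 2 * N * (Real.log 2 * S * k ^ 2) := by nlinarith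
    nlinarith
  exact (ENNReal.ofReal_lt_ofReal_iff_of_nonneg (by positivity)).2 hgoal

/-- A measure of finite energy charging the curve has a competitor of finite energy
with smaller mutual energy. -/
lemma exists_mutualEnergy_lt {γ : ℝ → Plane} {Γ : Set Plane} (hΓ : RegularCurve γ Γ)
    (μ : Measure Plane) [IsProbabilityMeasure μ] (h : 0 < μ Γ) (hE : mutualEnergy μ μ ≠ ⊤) :
    ∃ ν : Measure Plane, IsProbabilityMeasure ν ∧ mutualEnergy μ ν < mutualEnergy μ μ ∧
      mutualEnergy ν ν ≠ ⊤ := by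
  obtain ⟨r, hr, hlt⟩ := exists_radius_lt_lintegral_closedBall hΓ μ h
  have hle := mutualEnergy_conv_circle_add_le μ μ hr
  set ν := μ.conv (circleMeasure r)
  refine ⟨ν, inferInstance, ?_, ?_⟩
  · by_contra! hcon
    have h1 := ENNReal.add_lt_add_of_le_of_lt hE hcon hlt
    exact absurd hle (not_le.2 h1)
  · refine ne_top_of_le_ne_top (ENNReal.add_ne_top.2 ⟨?_, ENNReal.ofReal_ne_top⟩)
      (mutualEnergy_conv_circle_le ν μ hr)
    rw [mutualEnergy_comm]
    exact ne_top_of_le_ne_top (ENNReal.add_ne_top.2 ⟨hE, ENNReal.ofReal_ne_top⟩)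
      (mutualEnergy_conv_circle_le μ μ hr)

lemma integrable_norm_sq {μ : Measure Plane} [IsProbabilityMeasure μ]
    (hE : mutualEnergy μ μ ≠ ⊤) : Integrable (fun x : Plane => ‖x‖ ^ 2) μ := by
  have h : ∀ x : Plane, ENNReal.ofReal (3 / 8 * ‖x‖ ^ 2) ≤ ∫⁻ y, wKernel x y ∂μ := fun x => by
    calc ENNReal.ofReal (3 / 8 * ‖x‖ ^ 2) = ∫⁻ _, ENNReal.ofReal (3 / 8 * ‖x‖ ^ 2) ∂μ := by simp
      _ ≤ _ := by
        gcongr with y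
        refine (ENNReal.ofReal_le_ofReal ?_).trans (ofReal_wReal_le x y)
        exact le_trans (by nlinarith [sq_nonneg ‖y‖]) (le_wReal x y)
  have h1 : Integrable (fun x : Plane => 3 / 8 * ‖x‖ ^ 2) μ := by
    refine ⟨by fun_prop, ?_⟩
    rw [hasFiniteIntegral_iff_ofReal (Filter.Eventually.of_forall fun x => by positivity)]
    exact lt_of_le_of_lt (lintegral_mono h) (lt_top_iff_ne_top.2 hE)
  simpa [← mul_assoc] using h1.const_mul (8 / 3)

/-- Where the potential of `μ` is finite, it is given by `logPot`. -/
lemma lintegral_wKernel_toReal {μ : Measure Plane} [IsProbabilityMeasure μ]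
    (hE : mutualEnergy μ μ ≠ ⊤) {x : Plane} (hx : ∫⁻ y, wKernel x y ∂μ < ⊤) :
    (∫⁻ y, wKernel x y ∂μ).toReal =
      logPot μ x + ‖x‖ ^ 2 / 2 + ((∫ y, ‖y‖ ^ 2 ∂μ) / 2 + 1) := by
  have hmx : Measurable fun y => wKernel x y :=
    measurable_wKernel.comp (measurable_const.prodMk measurable_id)
  have hmr : Measurable fun y => wReal x y := by
    unfold wReal logKernel
    fun_prop
  have hae : ∀ᵐ y ∂μ, wKernel x y = ENNReal.ofReal (wReal x y) := by
    filter_upwards [ae_lt_top hmx hx.ne] with y hy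
    apply wKernel_of_ne
    rintro rfl
    simp [wKernel_self] at hy
  have h_int : Integrable (fun y => wReal x y) μ := by
    refine ⟨hmr.aestronglyMeasurable, ?_⟩
    rw [hasFiniteIntegral_iff_ofReal (Filter.Eventually.of_forall fun y => wReal_nonneg x y),
      ← lintegral_congr_ae hae]
    exact hx
  have hsq := integrable_norm_sq hE
  have hlog : Integrable (fun y => logKernel x y) μ := by
    have : (fun y => logKernel x y) = fun y => wReal x y - (‖x‖ ^ 2 / 2 + ‖y‖ ^ 2 / 2 + 1) := by
      ext y
      simp only [wReal]
      ring
    rw [this]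
    exact h_int.sub (((integrable_const _).add (hsq.div_const 2)).add (integrable_const _))
  rw [lintegral_congr_ae hae, ← integral_eq_lintegral_of_nonneg_ae
    (Filter.Eventually.of_forall fun y => wReal_nonneg x y) hmr.aestronglyMeasurable]
  have e : ∀ y, wReal x y = logKernel x y + (‖y‖ ^ 2 / 2 + (‖x‖ ^ 2 / 2 + 1)) := fun y => by
    simp only [wReal]
    ring
  simp_rw [e]
  have hquad : Integrable (fun y => ‖y‖ ^ 2 / 2 + (‖x‖ ^ 2 / 2 + 1)) μ :=
    (hsq.div_const 2).add (integrable_const _)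
  rw [integral_add hlog hquad,
    integral_add (hsq.div_const 2) (integrable_const _), integral_div, integral_const]
  simp only [probReal_univ, smul_eq_mul, one_mul, logPot]
  ring

lemma setIntegral_logPot {μ : Measure Plane} [IsProbabilityMeasure μ]
    (hE : mutualEnergy μ μ ≠ ⊤) (S : Set Plane) :
    ∫ x in S, (2 * logPot μ x + ‖x‖ ^ 2) ∂μ =
      2 * (mutualEnergy (μ.restrict S) μ).toReal -
        2 * ((∫ y, ‖y‖ ^ 2 ∂μ) / 2 + 1) * μ.real S := by
  have hm := measurable_lintegral_wKernel μ
  have hfin : ∫⁻ x in S, ∫⁻ y, wKernel x y ∂μ ∂μ ≠ ⊤ :=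
    ne_top_of_le_ne_top hE (setLIntegral_le_lintegral _ _)
  have hae : ∀ᵐ x ∂(μ.restrict S), 2 * logPot μ x + ‖x‖ ^ 2 =
      2 * (∫⁻ y, wKernel x y ∂μ).toReal - 2 * ((∫ y, ‖y‖ ^ 2 ∂μ) / 2 + 1) := by
    filter_upwards [ae_lt_top hm hfin] with x hx
    rw [lintegral_wKernel_toReal hE hx]
    ring
  rw [integral_congr_ae hae, integral_sub
    ((integrable_toReal_of_lintegral_ne_top hm.aemeasurable hfin).const_mul 2)
    (integrable_const _), integral_const_mul,
    integral_toReal hm.aemeasurable (ae_lt_top hm hfin), integral_const]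
  simp only [measureReal_restrict_apply_univ, smul_eq_mul, mutualEnergy]
  ring

lemma convexCombination_mem_Ma {Γ : Set Plane} {a : ℝ} {μ η : Measure Plane}
    (hμ : IsProbabilityMeasure μ) (hη : IsProbabilityMeasure η) {t : ℝ} (ht : 0 ≤ t) (ht1 : t ≤ 1)
    (h : a ≤ (1 - t) * μ.real Γ + t * η.real Γ) :
    ENNReal.ofReal (1 - t) • μ + ENNReal.ofReal t • η ∈ Ma Γ a := by
  have ht' : 0 ≤ 1 - t := by linarith
  refine ⟨⟨?_⟩, ?_⟩
  · simp only [Measure.add_apply, Measure.smul_apply, measure_univ, smul_eq_mul, mul_one]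
    rw [← ENNReal.ofReal_add ht' ht]
    simp
  · simp only [Measure.add_apply, Measure.smul_apply, smul_eq_mul]
    rw [← ofReal_measureReal (μ := μ), ← ofReal_measureReal (μ := η), ← ENNReal.ofReal_mul ht',
      ← ENNReal.ofReal_mul ht, ← ENNReal.ofReal_add (by positivity) (by positivity)]
    exact ENNReal.ofReal_le_ofReal h

lemma IsMinimizer.mutualEnergy_self_le {Γ : Set Plane} {a : ℝ} {μ η : Measure Plane}
    (hmin : IsMinimizer Γ a μ) (hη : IsProbabilityMeasure η) (hμη : mutualEnergy μ η ≠ ⊤)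
    (hηη : mutualEnergy η η ≠ ⊤) {t₀ : ℝ} (ht₀ : 0 < t₀) (ht₁ : t₀ ≤ 1)
    (h : ∀ t : ℝ, 0 < t → t ≤ t₀ → a ≤ (1 - t) * μ.real Γ + t * η.real Γ) :
    mutualEnergy μ μ ≤ mutualEnergy μ η := by
  obtain ⟨⟨hμ, -⟩, hfin, hle⟩ := hmin
  rw [wEnergy_eq_mutualEnergy] at hfin
  refine mutualEnergy_self_le_of_segment hfin.ne hμη hηη ht₀ ht₁ fun t ht htt => ?_
  have hmem := convexCombination_mem_Ma hμ hη ht.le (htt.trans ht₁) (h t ht htt)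
  have := hmem.1
  rw [← wEnergy_eq_mutualEnergy, ← wEnergy_eq_mutualEnergy]
  exact hle _ hmem

/-- the constants `A_Γ` and `A_0` associated with the minimizer
satisfy `A_Γ > A_0`. -/
theorem statement6 (γ : ℝ → Plane) (Γ : Set Plane) (hΓ : RegularCurve γ Γ)
    (a : ℝ) (ha : a ∈ Set.Ioo (0:ℝ) 1)
    (μa : Measure Plane) (hmin : IsMinimizer Γ a μa) :
    A0 Γ a μa < AΓ Γ a μa := by
  obtain ⟨ha0, ha1⟩ := ha
  obtain ⟨⟨hμ, hμΓ⟩, hfin, -⟩ := id hmin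
  rw [wEnergy_eq_mutualEnergy] at hfin
  have hmΓ : MeasurableSet Γ := hΓ.closed.measurableSet
  obtain ⟨ν, hν, hlt, hνν⟩ := exists_mutualEnergy_lt hΓ μa
    (lt_of_lt_of_le (ENNReal.ofReal_pos.2 ha0) hμΓ) hfin.ne
  have hμν : mutualEnergy μa ν ≠ ⊤ := hlt.ne_top
  have hab : a ≤ μa.real Γ := (ENNReal.ofReal_le_iff_le_toReal (measure_ne_top _ _)).1 hμΓ
  have hmass : μa.real Γ = a := by
    by_contra hne
    have hlt' : a < μa.real Γ := lt_of_le_of_ne hab (Ne.symm hne)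
    refine absurd hlt (not_lt.2 ?_)
    have hb1 : μa.real Γ ≤ 1 := measureReal_le_one
    refine hmin.mutualEnergy_self_le hν hμν hνν (t₀ := μa.real Γ - a) (by linarith)
      (by linarith) fun t ht htt => ?_
    have : 0 ≤ t * ν.real Γ := by positivity
    nlinarith
  have hmassc : μa.real Γᶜ = 1 - a := by rw [probReal_compl_eq_one_sub hmΓ, hmass]
  set κ := μa.restrict Γ with hκ
  set τ := μa.restrict Γᶜ with hτ
  have hsplit : mutualEnergy μa μa = mutualEnergy κ μa + mutualEnergy τ μa := by
    rw [← mutualEnergy_add_left, Measure.restrict_add_restrict_compl hmΓ]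
  have hκμ : mutualEnergy κ μa ≠ ⊤ :=
    ne_top_of_le_ne_top hfin.ne (mutualEnergy_mono_left Measure.restrict_le_self _)
  have hτμ : mutualEnergy τ μa ≠ ⊤ :=
    ne_top_of_le_ne_top hfin.ne (mutualEnergy_mono_left Measure.restrict_le_self _)
  have hκκ : mutualEnergy κ κ ≠ ⊤ := by
    refine ne_top_of_le_ne_top hκμ ?_
    rw [mutualEnergy_comm κ μa]
    exact mutualEnergy_mono_left Measure.restrict_le_self _
  have hκν : mutualEnergy κ ν ≠ ⊤ :=
    ne_top_of_le_ne_top hμν (mutualEnergy_mono_left Measure.restrict_le_self _)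
  have : IsFiniteMeasure (ENNReal.ofReal (1 - a) • ν) :=
    Measure.smul_finite ν ENNReal.ofReal_ne_top
  have hηp : IsProbabilityMeasure (κ + ENNReal.ofReal (1 - a) • ν) := by
    constructor
    simp only [Measure.add_apply, Measure.smul_apply, measure_univ, smul_eq_mul, mul_one, hκ,
      Measure.restrict_apply_univ]
    rw [← ofReal_measureReal (μ := μa), hmass, ← ENNReal.ofReal_add ha0.le (by linarith)]
    simp
  have hηΓ : a ≤ (κ + ENNReal.ofReal (1 - a) • ν).real Γ := by
    rw [measureReal_add_apply, hκ, measureReal_restrict_apply_self, hmass]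
    exact le_add_of_nonneg_right measureReal_nonneg
  have hμη : mutualEnergy μa (κ + ENNReal.ofReal (1 - a) • ν) =
      mutualEnergy κ μa + ENNReal.ofReal (1 - a) * mutualEnergy μa ν := by
    rw [mutualEnergy_add_right, mutualEnergy_smul_right, mutualEnergy_comm μa κ]
  have hle : mutualEnergy μa μa ≤ mutualEnergy μa (κ + ENNReal.ofReal (1 - a) • ν) := by
    refine hmin.mutualEnergy_self_le hηp ?_ ?_ one_pos le_rfl fun t ht htt => ?_
    · rw [hμη]
      exact ENNReal.add_ne_top.2 ⟨hκμ, ENNReal.mul_ne_top ENNReal.ofReal_ne_top hμν⟩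
    · simp only [mutualEnergy_add_left, mutualEnergy_add_right, mutualEnergy_smul_left,
        mutualEnergy_smul_right, mutualEnergy_comm ν κ]
      finiteness
    · rw [hmass]
      nlinarith
  rw [hμη, hsplit, ENNReal.add_le_add_iff_left hκμ] at hle
  rw [hsplit] at hlt
  have hle' := ENNReal.toReal_mono (ENNReal.mul_ne_top ENNReal.ofReal_ne_top hμν) hle
  have hlt' := ENNReal.toReal_strict_mono (ENNReal.add_ne_top.2 ⟨hκμ, hτμ⟩) hlt
  rw [ENNReal.toReal_mul, ENNReal.toReal_ofReal (by linarith)] at hle'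
  rw [ENNReal.toReal_add hκμ hτμ] at hlt'
  rw [A0, AΓ, setIntegral_logPot hfin.ne, setIntegral_logPot hfin.ne, hmass, hmassc,
    ← hκ, ← hτ]
  generalize (mutualEnergy κ μa).toReal = p at *
  generalize (mutualEnergy τ μa).toReal = q at *
  generalize (mutualEnergy μa ν).toReal = s at *
  generalize (∫ y, ‖y‖ ^ 2 ∂μa) / 2 + 1 = C
  have h1a : 0 < 1 - a := by linarith
  have hpq : (1 - a)⁻¹ * q < a⁻¹ * p := by
    rw [inv_mul_eq_div, inv_mul_eq_div, div_lt_div_iff₀ h1a ha0]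
    nlinarith
  have e1 : (1 - a)⁻¹ * (2 * q - 2 * C * (1 - a)) = 2 * ((1 - a)⁻¹ * q) - 2 * C := by
    field_simp
  have e2 : a⁻¹ * (2 * p - 2 * C * a) = 2 * (a⁻¹ * p) - 2 * C := by
    field_simp
  rw [e1, e2]
  linarith
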